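/- Let G be a connected planar graph on n vertices with minimum degree 2, and suppose the number of degree-2 vertices of G is at most c·n. Then G has a matching of size at least n/3 − (2/3)·c·n. (In particular, adding for each degree-2 vertex v a new vertex v' adjacent to v and to both neighbors of v yields a planar graph of minimum degree 3, and any large matching of the new graph yields the claimed matching of G via Nishizeki's bound that connected planar graphs of minimum degree 3 on m ≥ 10 vertices have matchings of size at least ⌈(m+2)/3⌉.) -/

import Mathlib

open Set Bornology

/-- A plane embedding of a simple graph: each vertex is mapped to a point of the
plane, each edge to an injective arc joining its endpoints; arcs avoid vertices
other than their endpoints and distinct arcs meet only at common endpoints. -/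
structure PlaneEmbedding {V : Type} (G : SimpleGraph V) where
  pos : V → ℝ × ℝ
  pos_inj : Function.Injective pos
  arc : G.edgeSet → Set (ℝ × ℝ)
  arc_path : ∀ e : G.edgeSet, ∃ u v : V, (e : Sym2 V) = s(u, v) ∧
    ∃ γ : Path (pos u) (pos v), Function.Injective ⇑γ ∧ Set.range ⇑γ = arc e
  arc_avoid : ∀ (e : G.edgeSet) (w : V), pos w ∈ arc e → w ∈ (e : Sym2 V)
  arc_inter : ∀ e f : G.edgeSet, e ≠ f → ∀ x ∈ arc e ∩ arc f,
    ∃ w : V, w ∈ (e : Sym2 V) ∧ w ∈ (f : Sym2 V) ∧ x = pos w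

namespace PlaneEmbedding

variable {V : Type} {G : SimpleGraph V}

/-- The image (drawing) of the plane graph in the plane. -/
def image (P : PlaneEmbedding G) : Set (ℝ × ℝ) :=
  Set.range P.pos ∪ ⋃ e : G.edgeSet, P.arc e

/-- A face: a connected component of the complement of the image. -/
def IsFace (P : PlaneEmbedding G) (f : Set (ℝ × ℝ)) : Prop :=
  ∃ x, x ∉ P.image ∧ f = connectedComponentIn (P.image)ᶜ x

def IsBoundedFace (P : PlaneEmbedding G) (f : Set (ℝ × ℝ)) : Prop :=
  P.IsFace f ∧ IsBounded f

def IsOuterFace (P : PlaneEmbedding G) (f : Set (ℝ × ℝ)) : Prop :=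
  P.IsFace f ∧ ¬ IsBounded f

/-- The vertices on the boundary of a face `f`. -/
def boundaryVerts (P : PlaneEmbedding G) (f : Set (ℝ × ℝ)) : Set V :=
  {v | P.pos v ∈ closure f}

/-- The weak dual: vertices are the bounded faces, two distinct faces being
adjacent when some edge lies on the boundary of both. -/
def weakDual (P : PlaneEmbedding G) :
    SimpleGraph {f : Set (ℝ × ℝ) // P.IsBoundedFace f} :=
  SimpleGraph.fromRel fun f g =>
    ∃ e : G.edgeSet, P.arc e ⊆ closure f.1 ∧ P.arc e ⊆ closure g.1

/-- `u⁺`: the bounded faces having `u` on their boundary. -/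
def uPlus (P : PlaneEmbedding G) (u : V) :
    Set {f : Set (ℝ × ℝ) // P.IsBoundedFace f} :=
  {f | u ∈ P.boundaryVerts f.1}

/-- The drawing of the subgraph induced by a set `S` of vertices. -/
def subImage (P : PlaneEmbedding G) (S : Set V) : Set (ℝ × ℝ) :=
  P.pos '' S ∪ ⋃ e ∈ {e : G.edgeSet | ∀ w, w ∈ (e : Sym2 V) → w ∈ S}, P.arc e

/-- The vertices of `S` lying on the boundary of the unbounded face of the
drawing of the subgraph induced by `S`. -/
def outerVerts (P : PlaneEmbedding G) (S : Set V) : Set V :=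
  {v | v ∈ S ∧ ∃ x, x ∉ P.subImage S ∧
    ¬ IsBounded (connectedComponentIn (P.subImage S)ᶜ x) ∧
    P.pos v ∈ closure (connectedComponentIn (P.subImage S)ᶜ x)}

/-- Remove the outer layer of vertices. -/
def peel (P : PlaneEmbedding G) (S : Set V) : Set V := S \ P.outerVerts S

/-- The embedding is (at most) `k`-outerplanar: `k` rounds of removing the
vertices on the outer boundary remove every vertex. -/
def OuterplanarAtMost (P : PlaneEmbedding G) (k : ℕ) : Prop :=
  (P.peel)^[k] Set.univ = ∅

/-- The drawing of the subgraph of all edges incident to vertices of `R`. -/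
def familyImage (P : PlaneEmbedding G) (R : Set V) : Set (ℝ × ℝ) :=
  ⋃ e ∈ {e : G.edgeSet | ∃ v ∈ R, v ∈ (e : Sym2 V)}, P.arc e

/-- `R` is nicely embedded: no bounded face of the subgraph of edges incident
to `R` strictly encloses a vertex of `G`. -/
def NicelyEmbedded (P : PlaneEmbedding G) (R : Set V) : Prop :=
  ∀ x, x ∉ P.familyImage R →
    IsBounded (connectedComponentIn (P.familyImage R)ᶜ x) →
    ∀ v : V, P.pos v ∉ connectedComponentIn (P.familyImage R)ᶜ x

/-- The facial completion: add a clique on the boundary of each bounded face. -/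
def facialCompletion (P : PlaneEmbedding G) : SimpleGraph V :=
  G ⊔ SimpleGraph.fromRel fun u v =>
    ∃ f, P.IsBoundedFace f ∧ u ∈ P.boundaryVerts f ∧ v ∈ P.boundaryVerts f

end PlaneEmbedding

/-- A tree together with a bag of vertices at each node. -/
structure Decomp (V : Type) : Type 1 where
  ι : Type
  tree : SimpleGraph ι
  isTree : tree.IsTree
  bag : ι → Set V

/-- `D` is a tree decomposition of `G`. -/
def IsTreeDecomp {V : Type} (G : SimpleGraph V) (D : Decomp V) : Prop :=
  (∀ v, ∃ i, v ∈ D.bag i) ∧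
  (∀ u v, G.Adj u v → ∃ i, u ∈ D.bag i ∧ v ∈ D.bag i) ∧
  (∀ v, (D.tree.induce {i | v ∈ D.bag i}).Connected)

/-- The treewidth of a graph. -/
noncomputable def treewidth {V : Type} (G : SimpleGraph V) : ℕ :=
  sInf {k | ∃ D : Decomp V, IsTreeDecomp G D ∧ ∀ i, (D.bag i).ncard ≤ k + 1}

/-- `D` is an embedded tree decomposition of the plane graph given by `P`. -/
def IsEmDecomp {V : Type} {G : SimpleGraph V} (P : PlaneEmbedding G)
    (D : Decomp V) : Prop :=
  IsTreeDecomp G D ∧ ∀ f, P.IsBoundedFace f → ∃ i, P.boundaryVerts f ⊆ D.bag i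

/-- The em-width of a plane graph. -/
noncomputable def emwidth {V : Type} {G : SimpleGraph V}
    (P : PlaneEmbedding G) : ℕ :=
  sInf {k | ∃ D : Decomp V, IsEmDecomp P D ∧ ∀ i, (D.bag i).ncard ≤ k + 1}

/-- A cut vertex: its removal disconnects two vertices that were connected. -/
def SimpleGraph.IsCutVertex {V : Type} (G : SimpleGraph V) (u : V) : Prop :=
  ∃ x y, ∃ (hx : x ≠ u) (hy : y ≠ u), G.Reachable x y ∧
    ¬ (G.induce {v | v ≠ u}).Reachable ⟨x, hx⟩ ⟨y, hy⟩

/-- An `r`-family: `r` vertices of degree 2 sharing the same two neighbors. -/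
def IsRFamily {V : Type} (G : SimpleGraph V) (R : Set V) (r : ℕ) : Prop :=
  R.ncard = r ∧ ∃ a b : V, a ≠ b ∧ ∀ v ∈ R, G.neighborSet v = {a, b}



/-- `w` is the total change, over the unit interval, of a continuous logarithm of `g`. -/
def IsLogIncrement (g : ℝ → ℂ) (w : ℂ) : Prop :=
  ∃ L : ℝ → ℂ, Continuous L ∧ (∀ t, Complex.exp (L t) = g t) ∧ L 1 - L 0 = w

theorem IsLogIncrement.unique {g : ℝ → ℂ} {w w' : ℂ} (h : IsLogIncrement g w)
    (h' : IsLogIncrement g w') : w = w' := by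
  obtain ⟨L, hL, he, rfl⟩ := h
  obtain ⟨L', hL', he', rfl⟩ := h'
  have h0 : Complex.exp (L 0 - L' 0) = 1 := by
    rw [Complex.exp_sub, he, he', div_self]
    rw [← he]; exact Complex.exp_ne_zero _
  have := Complex.isCoveringMap_exp.eq_of_comp_eq (A := ℝ) (g₁ := L)
    (g₂ := fun t => L' t + (L 0 - L' 0)) hL (by fun_prop)
    (by funext t; apply Subtype.ext; simp [Complex.exp_add, he, he', h0]) 0 (by simp)
  have h1 : L 1 = L' 1 + (L 0 - L' 0) := congrFun this 1
  rw [h1]; ring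

theorem exists_continuous_log {E : Type*} [NormedAddCommGroup E] [NormedSpace ℝ E]
    {g : E → ℂ} (hg : Continuous g) (h0 : ∀ x, g x ≠ 0) :
    ∃ L : E → ℂ, Continuous L ∧ ∀ x, Complex.exp (L x) = g x := by
  obtain ⟨F, ⟨-, hF⟩, -⟩ := Complex.isCoveringMapOn_exp.existsUnique_continuousMap_lifts
    (⟨g, hg⟩ : C(E, ℂ)) (a₀ := 0) (e₀ := Complex.log (g 0))
    (by simp [Complex.exp_log (h0 0)]) (by simpa using h0)
  exact ⟨F, F.continuous, fun x => congrFun hF x⟩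

theorem exists_isLogIncrement {g : ℝ → ℂ} (hg : Continuous g) (h0 : ∀ x, g x ≠ 0) :
    ∃ w, IsLogIncrement g w := by
  obtain ⟨L, hL, he⟩ := exists_continuous_log hg h0
  exact ⟨_, L, hL, he, rfl⟩

theorem IsLogIncrement.neg {g : ℝ → ℂ} {w : ℂ} (h : IsLogIncrement g w) :
    IsLogIncrement (fun t => - g t) w := by
  obtain ⟨L, hL, he, rfl⟩ := h
  exact ⟨fun t => L t + Real.pi * Complex.I, by fun_prop,
    fun t => by simp [Complex.exp_add, he], by ring⟩

theorem IsLogIncrement.exists_int {g : ℝ → ℂ} {w a b : ℂ} (h : IsLogIncrement g w)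
    (ha : Complex.exp a = g 0) (hb : Complex.exp b = g 1) :
    ∃ n : ℤ, w = b - a + n * (2 * Real.pi * Complex.I) := by
  obtain ⟨L, hL, he, rfl⟩ := h
  apply Complex.exp_eq_exp_iff_exists_int.1
  rw [Complex.exp_sub, Complex.exp_sub, he, he, ha, hb]

/-- The winding relation for two disjoint curves, read off the boundary of the unit square. -/
theorem logIncrement_sub_eq {γ δ : ℝ → ℂ} (hγ : Continuous γ) (hδ : Continuous δ)
    (hne : ∀ s t, γ s ≠ δ t) {a b c d : ℂ}
    (ha : IsLogIncrement (fun t => δ t - γ 0) a) (hb : IsLogIncrement (fun t => δ t - γ 1) b)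
    (hc : IsLogIncrement (fun t => γ t - δ 0) c) (hd : IsLogIncrement (fun t => γ t - δ 1) d) :
    b - a = d - c := by
  obtain ⟨L, hL, he⟩ := exists_continuous_log (g := fun x : ℝ × ℝ => γ x.1 - δ x.2)
    (by fun_prop) (fun x => sub_ne_zero.2 (hne _ _))
  have ha' : IsLogIncrement (fun t => δ t - γ 0) (L (0, 1) - L (0, 0)) := by
    simpa using IsLogIncrement.neg (g := fun t => γ 0 - δ t)
      ⟨fun t => L (0, t), by fun_prop, fun t => he (0, t), rfl⟩
  have hb' : IsLogIncrement (fun t => δ t - γ 1) (L (1, 1) - L (1, 0)) := by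
    simpa using IsLogIncrement.neg (g := fun t => γ 1 - δ t)
      ⟨fun t => L (1, t), by fun_prop, fun t => he (1, t), rfl⟩
  have hc' : IsLogIncrement (fun t => γ t - δ 0) (L (1, 0) - L (0, 0)) :=
    ⟨fun t => L (t, 0), by fun_prop, fun t => he (t, 0), rfl⟩
  have hd' : IsLogIncrement (fun t => γ t - δ 1) (L (1, 1) - L (0, 1)) :=
    ⟨fun t => L (t, 1), by fun_prop, fun t => he (t, 1), rfl⟩
  rw [ha.unique ha', hb.unique hb', hc.unique hc', hd.unique hd']
  ring

/-- Logarithms of the pairwise differences that change by exactly `πi` under a swap. -/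
theorem exists_log_sub {p : Fin 3 → ℂ} (hp : Function.Injective p) :
    ∃ A : Fin 3 → Fin 3 → ℂ, (∀ i k, i ≠ k → Complex.exp (A i k) = p k - p i) ∧
      ∀ i k, i < k → A k i = A i k + Real.pi * Complex.I := by
  refine ⟨fun i k => if i < k then Complex.log (p k - p i) else
    Complex.log (p i - p k) + Real.pi * Complex.I, fun i k h => ?_, fun i k h => ?_⟩
  · have h1 : p k - p i ≠ 0 := sub_ne_zero.2 (hp.ne h.symm)
    have h2 : p i - p k ≠ 0 := sub_ne_zero.2 (hp.ne h)
    dsimp only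
    split_ifs
    · rw [Complex.exp_log h1]
    · rw [Complex.exp_add, Complex.exp_log h2, Complex.exp_pi_mul_I]; ring
  · simp [h, h.not_gt]

/-- The complete bipartite graph `K₃,₃` cannot be drawn in the plane so that curves
representing edges without a common endpoint are disjoint. -/
theorem false_of_drawing_K33 (p q : Fin 3 → ℂ) (γ : Fin 3 → Fin 3 → ℝ → ℂ)
    (hγ : ∀ i j, Continuous (γ i j)) (h0 : ∀ i j, γ i j 0 = p i) (h1 : ∀ i j, γ i j 1 = q j)
    (hd : ∀ i j k l, i ≠ k → j ≠ l → ∀ s t, γ i j s ≠ γ k l t) : False := by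
  have other : ∀ i : Fin 3, ∃ j, i ≠ j := by decide
  have hp : ∀ i k l, i ≠ k → ∀ t, γ k l t - p i ≠ 0 := fun i k l h t => by
    obtain ⟨j, hj⟩ := other l
    rw [← h0 i j]
    exact sub_ne_zero.2 (hd _ _ _ _ h.symm hj _ _)
  have hq : ∀ j k l, j ≠ l → ∀ t, γ k l t - q j ≠ 0 := fun j k l h t => by
    obtain ⟨i, hi⟩ := other k
    rw [← h1 i j]
    exact sub_ne_zero.2 (hd _ _ _ _ hi h.symm _ _)
  have hpq : ∀ i j, q j - p i ≠ 0 := fun i j => by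
    obtain ⟨k, hk⟩ := other i
    rw [← h1 k j]
    exact hp _ _ _ hk _
  obtain ⟨A, hA, hA'⟩ := exists_log_sub (p := p) (fun i k h => by
    by_contra hik
    exact hp i k 0 hik 0 (by rw [h0, h, sub_self]))
  obtain ⟨C, hC, hC'⟩ := exists_log_sub (p := q) (fun i k h => by
    by_contra hik
    exact hq i 0 k hik 1 (by rw [h1, h, sub_self]))
  have eP : ∀ i k l, ∃ n : ℤ, i ≠ k → IsLogIncrement (fun t => γ k l t - p i)
      (Complex.log (q l - p i) - A i k + n * (2 * Real.pi * Complex.I)) := fun i k l => by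
    by_cases h : i = k
    · exact ⟨0, fun h' => absurd h h'⟩
    · obtain ⟨w, hw⟩ := exists_isLogIncrement (g := fun t => γ k l t - p i)
        ((hγ k l).sub continuous_const) (hp i k l h)
      obtain ⟨n, rfl⟩ := hw.exists_int (a := A i k) (b := Complex.log (q l - p i))
        (by rw [hA i k h, h0]) (by rw [Complex.exp_log (hpq _ _), h1])
      exact ⟨n, fun _ => hw⟩
  have eQ : ∀ j k l, ∃ n : ℤ, j ≠ l → IsLogIncrement (fun t => γ k l t - q j)
      (C j l - (Complex.log (q j - p k) + Real.pi * Complex.I) +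
        n * (2 * Real.pi * Complex.I)) := fun j k l => by
    by_cases h : j = l
    · exact ⟨0, fun h' => absurd h h'⟩
    · obtain ⟨w, hw⟩ := exists_isLogIncrement (g := fun t => γ k l t - q j)
        ((hγ k l).sub continuous_const) (hq j k l h)
      obtain ⟨n, rfl⟩ := hw.exists_int (a := Complex.log (q j - p k) + Real.pi * Complex.I)
        (b := C j l)
        (by rw [Complex.exp_add, Complex.exp_log (hpq _ _), Complex.exp_pi_mul_I, h0]; ring)
        (by rw [hC _ _ h, h1])
      exact ⟨n, fun _ => hw⟩
  choose P hP using eP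
  choose Q hQ using eQ
  have key : ∀ i j k l, i ≠ k → j ≠ l → C j l - C l j + (A i k - A k i) =
      ((Q l i j - P k i j - Q j k l + P i k l : ℤ) : ℂ) * (2 * Real.pi * Complex.I) := by
    intro i j k l hik hjl
    have := logIncrement_sub_eq (hγ i j) (hγ k l) (hd i j k l hik hjl)
      (by simpa only [h0] using hP i k l hik) (by simpa only [h1] using hQ j k l hjl)
      (by simpa only [h0] using hP k i j hik.symm) (by simpa only [h1] using hQ l i j hjl.symm)
    push_cast
    linear_combination this
  have hpi : (2 * Real.pi * Complex.I : ℂ) ≠ 0 := Complex.two_pi_I_ne_zero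
  have key1 : ∀ i j k l, i < k → j < l → Q l i j - P k i j - Q j k l + P i k l = -1 := by
    intro i j k l hik hjl
    have := key i j k l hik.ne hjl.ne
    rw [hA' i k hik, hC' j l hjl] at this
    have h2 : ((Q l i j - P k i j - Q j k l + P i k l : ℤ) : ℂ) = ((-1 : ℤ) : ℂ) := by
      apply mul_right_cancel₀ hpi
      push_cast at this ⊢
      linear_combination -this
    exact_mod_cast h2
  have key2 : ∀ i j k l, i < k → l < j → Q l i j - P k i j - Q j k l + P i k l = 0 := by
    intro i j k l hik hjl
    have := key i j k l hik.ne hjl.ne'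
    rw [hA' i k hik, hC' l j hjl] at this
    have h2 : ((Q l i j - P k i j - Q j k l + P i k l : ℤ) : ℂ) = ((0 : ℤ) : ℂ) := by
      apply mul_right_cancel₀ hpi
      push_cast at this ⊢
      linear_combination -this
    exact_mod_cast h2
  have h01 : (0 : Fin 3) < 1 := by decide
  have h02 : (0 : Fin 3) < 2 := by decide
  have h12 : (1 : Fin 3) < 2 := by decide
  have e1 := key1 _ _ _ _ h01 h01
  have e2 := key1 _ _ _ _ h01 h02
  have e3 := key1 _ _ _ _ h01 h12
  have e4 := key1 _ _ _ _ h02 h01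
  have e5 := key1 _ _ _ _ h02 h02
  have e6 := key1 _ _ _ _ h02 h12
  have e7 := key1 _ _ _ _ h12 h01
  have e8 := key1 _ _ _ _ h12 h02
  have e9 := key1 _ _ _ _ h12 h12
  have f1 := key2 _ _ _ _ h01 h01
  have f2 := key2 _ _ _ _ h01 h02
  have f3 := key2 _ _ _ _ h01 h12
  have f4 := key2 _ _ _ _ h02 h01
  have f5 := key2 _ _ _ _ h02 h02
  have f6 := key2 _ _ _ _ h02 h12
  have f7 := key2 _ _ _ _ h12 h01
  have f8 := key2 _ _ _ _ h12 h02
  have f9 := key2 _ _ _ _ h12 h12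
  omega

namespace PlaneEmbedding

variable {V : Type} {G : SimpleGraph V}

theorem disjoint_subImage (P : PlaneEmbedding G) {S T : Set V} (h : Disjoint S T) :
    Disjoint (P.subImage S) (P.subImage T) := by
  rw [Set.disjoint_left] at h ⊢
  have key : ∀ {S' : Set V} {w : V} {e : G.edgeSet}, (∀ w, w ∈ (e : Sym2 V) → w ∈ S') →
      P.pos w ∈ P.arc e → w ∈ S' := fun he hw => he _ (P.arc_avoid _ _ hw)
  rintro x (⟨v, hv, rfl⟩ | hx) hx'
  · obtain (⟨w, hw, hwv⟩ | hx') := hx'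
    · exact h hv (P.pos_inj hwv ▸ hw)
    · simp only [Set.mem_iUnion] at hx'
      obtain ⟨e, he, hx'⟩ := hx'
      exact h hv (key he hx')
  · simp only [Set.mem_iUnion] at hx
    obtain ⟨e, he, hx⟩ := hx
    obtain (⟨w, hw, rfl⟩ | hx') := hx'
    · exact h (key he hx) hw
    · simp only [Set.mem_iUnion] at hx'
      obtain ⟨f, hf, hx'⟩ := hx'
      by_cases hef : e = f
      · subst hef
        obtain ⟨u, v, huv, -⟩ := P.arc_path e
        have hu : u ∈ (e : Sym2 V) := huv ▸ Sym2.mem_mk_left u v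
        exact h (he u hu) (hf u hu)
      · obtain ⟨w, hwe, hwf, -⟩ := P.arc_inter e f hef x ⟨hx, hx'⟩
        exact h (he w hwe) (hf w hwf)

theorem joinedIn_subImage_of_adj (P : PlaneEmbedding G) {S : Set V} {u v : V} (hu : u ∈ S)
    (hv : v ∈ S) (h : G.Adj u v) : JoinedIn (P.subImage S) (P.pos u) (P.pos v) := by
  obtain ⟨a, b, hab, γ, -, hγ⟩ := P.arc_path ⟨s(u, v), h⟩
  have hj : JoinedIn (P.subImage S) (P.pos a) (P.pos b) := by
    refine ⟨γ, fun t => Or.inr ?_⟩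
    simp only [Set.mem_iUnion]
    refine ⟨⟨s(u, v), h⟩, fun w hw => ?_, hγ ▸ Set.mem_range_self t⟩
    rcases Sym2.mem_iff.1 hw with rfl | rfl <;> assumption
  rcases Sym2.eq_iff.1 hab with ⟨rfl, rfl⟩ | ⟨rfl, rfl⟩
  · exact hj
  · exact hj.symm

theorem joinedIn_subImage (P : PlaneEmbedding G) {S : Set V} (hS : (G.induce S).Preconnected)
    {u v : V} (hu : u ∈ S) (hv : v ∈ S) : JoinedIn (P.subImage S) (P.pos u) (P.pos v) := by
  obtain ⟨p⟩ := hS ⟨u, hu⟩ ⟨v, hv⟩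
  suffices ∀ (x y : S), (G.induce S).Walk x y → JoinedIn (P.subImage S) (P.pos x) (P.pos y) from
    this _ _ p
  intro x y p
  induction p with
  | nil => exact JoinedIn.refl (Or.inl ⟨_, Subtype.prop _, rfl⟩)
  | cons h p ih => exact (P.joinedIn_subImage_of_adj (Subtype.prop _) (Subtype.prop _) h).trans ih

/-- A plane graph has no `K₃,₃` minor: `X i j` is the union of the branch sets of the
`i`-th vertex `a i` on one side and of the `j`-th vertex `b j` on the other side. -/
theorem false_of_K33_minor (P : PlaneEmbedding G) (a b : Fin 3 → V) (X : Fin 3 → Fin 3 → Set V)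
    (ha : ∀ i j, a i ∈ X i j) (hb : ∀ i j, b j ∈ X i j)
    (hX : ∀ i j, (G.induce (X i j)).Preconnected)
    (hd : ∀ i j k l, i ≠ k → j ≠ l → Disjoint (X i j) (X k l)) : False := by
  choose γ hγ using fun i j => P.joinedIn_subImage (hX i j) (ha i j) (hb i j)
  let φ := Complex.equivRealProdCLM.symm
  refine false_of_drawing_K33 (fun i => φ (P.pos (a i))) (fun j => φ (P.pos (b j)))
    (fun i j t => φ ((γ i j).extend t)) (fun i j => φ.continuous.comp (γ i j).continuous_extend)
    (by simp) (by simp) fun i j k l hik hjl s t h => ?_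
  have hmem : ∀ i j t, (γ i j).extend t ∈ P.subImage (X i j) := fun i j t => by
    have : (γ i j).extend t ∈ Set.range (γ i j) := by
      rw [← (γ i j).extend_range]; exact Set.mem_range_self t
    obtain ⟨t', ht'⟩ := this
    exact ht' ▸ hγ i j t'
  exact Set.disjoint_left.1 (P.disjoint_subImage (hd i j k l hik hjl)) (hmem i j s)
    (φ.injective h ▸ hmem k l t)

end PlaneEmbedding

namespace SimpleGraph

variable {V ι : Type} {G : SimpleGraph V}

theorem Connected.induce_insert {s : Set V} (hs : (G.induce s).Connected) {u v : V} (hu : u ∈ s)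
    (h : G.Adj v u) : (G.induce (insert v s)).Connected := by
  have : insert v s = s ∪ {u, v} := by
    ext w; simp only [Set.mem_insert_iff, Set.mem_union, Set.mem_singleton_iff]; grind
  rw [this]
  exact induce_union_connected hs.preconnected (induce_pair_connected_of_adj h.symm).preconnected
    ⟨u, hu, by simp⟩

/-- A `K₃,₃` minor of `G` with three connected branch sets on one side and three single vertices
on the other. -/
structure IsK33Model (G : SimpleGraph V) (A : Fin 3 → Set V) (t : Fin 3 → V) : Prop where
  connected : ∀ i, (G.induce (A i)).Connected
  disjoint : ∀ i k, i ≠ k → Disjoint (A i) (A k)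
  injective : Function.Injective t
  notMem : ∀ i j, t j ∉ A i
  adj : ∀ i j, ∃ u ∈ A i, G.Adj (t j) u

theorem IsK33Model.false_of_planeEmbedding {A : Fin 3 → Set V} {t : Fin 3 → V}
    (h : G.IsK33Model A t) (P : PlaneEmbedding G) : False := by
  choose a ha using fun i => Set.nonempty_coe_sort.1 (h.connected i).nonempty
  refine P.false_of_K33_minor a t (fun i j => insert (t j) (A i))
    (fun i j => Or.inr (ha i)) (fun i j => Or.inl rfl) (fun i j => ?_) fun i j k l hik hjl => ?_
  · obtain ⟨u, hu, hadj⟩ := h.adj i j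
    exact ((h.connected i).induce_insert hu hadj).preconnected
  · rw [Set.disjoint_insert_left, Set.disjoint_insert_right]
    refine ⟨?_, h.notMem i l, h.disjoint i k hik⟩
    rintro (hh | hh)
    · exact hjl (h.injective hh)
    · exact h.notMem k j hh

/-- A bipartite minor of `G`: its parts are the disjoint connected branch sets `B i`, `i ∈ S`, and
the vertices `t ∈ T`, each of which is joined to the three branch sets with index in `N t`. -/
structure IsTripleModel (G : SimpleGraph V) (S : Finset ι) (T : Finset V) (B : ι → Set V)
    (N : V → Finset ι) : Prop where
  connected : ∀ i ∈ S, (G.induce (B i)).Connected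
  disjoint : ∀ i ∈ S, ∀ j ∈ S, i ≠ j → Disjoint (B i) (B j)
  notMem : ∀ t ∈ T, ∀ i ∈ S, t ∉ B i
  subset : ∀ t ∈ T, N t ⊆ S
  card_eq : ∀ t ∈ T, (N t).card = 3
  adj : ∀ t ∈ T, ∀ i ∈ N t, ∃ u ∈ B i, G.Adj t u

/-- `i` and `j` are connected by triples without using `x` or `y`. -/
def LinkedAvoiding (T : Finset V) (N : V → Finset ι) (x y : ι) : ι → ι → Prop :=
  Relation.ReflTransGen fun i j =>
    (i ≠ x ∧ i ≠ y) ∧ (j ≠ x ∧ j ≠ y) ∧ ∃ t ∈ T, i ∈ N t ∧ j ∈ N t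

theorem LinkedAvoiding.symm {T : Finset V} {N : V → Finset ι} {x y i j : ι}
    (h : LinkedAvoiding T N x y i j) : LinkedAvoiding T N x y j i := by
  induction h with
  | refl => exact Relation.ReflTransGen.refl
  | tail _ h ih =>
    obtain ⟨hi, hj, t, ht, h1, h2⟩ := h
    exact ih.head ⟨hj, hi, t, ht, h2, h1⟩

theorem LinkedAvoiding.ne {T : Finset V} {N : V → Finset ι} {x y i j : ι}
    (h : LinkedAvoiding T N x y i j) (hx : i ≠ x) (hy : i ≠ y) : j ≠ x ∧ j ≠ y := by
  induction h with
  | refl => exact ⟨hx, hy⟩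
  | tail _ h _ => exact h.2.1

namespace IsTripleModel

variable {S : Finset ι} {T : Finset V} {B : ι → Set V} {N : V → Finset ι}

theorem exists_connected_of_linkedAvoiding (h : G.IsTripleModel S T B N) {x y z i : ι}
    (hz : z ∈ S) (hzx : z ≠ x) (hzy : z ≠ y) (hl : LinkedAvoiding T N x y z i) :
    i ∈ S ∧ ∃ A : Set V, (G.induce A).Connected ∧ B z ⊆ A ∧ B i ⊆ A ∧
      ∀ v ∈ A, (∃ j ∈ S, j ≠ x ∧ j ≠ y ∧ v ∈ B j) ∨
        ∃ j k, j ∈ N v ∧ k ∈ N v ∧ j ≠ k ∧ j ≠ x ∧ j ≠ y ∧ k ≠ x ∧ k ≠ y ∧ v ∈ T := by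
  induction hl with
  | refl =>
    exact ⟨hz, B z, h.connected z hz, subset_rfl, subset_rfl,
      fun v hv => Or.inl ⟨z, hz, hzx, hzy, hv⟩⟩
  | @tail j k _ hjk ih =>
    obtain ⟨hj, A, hA, hzA, hjA, hAU⟩ := ih
    obtain ⟨⟨hjx, hjy⟩, ⟨hkx, hky⟩, t, ht, hjt, hkt⟩ := hjk
    have hk := h.subset t ht hkt
    refine ⟨hk, ?_⟩
    by_cases hne : j = k
    · exact ⟨A, hA, hzA, hne ▸ hjA, hAU⟩
    obtain ⟨u, hu, htu⟩ := h.adj t ht j hjt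
    obtain ⟨w, hw, htw⟩ := h.adj t ht k hkt
    refine ⟨insert t A ∪ insert t (B k), ?_, fun v hv => Or.inl (Or.inr (hzA hv)),
      fun v hv => Or.inr (Or.inr hv), ?_⟩
    · exact induce_union_connected (hA.induce_insert (hjA hu) htu).preconnected
        ((h.connected k hk).induce_insert hw htw).preconnected ⟨t, Or.inl rfl, Or.inl rfl⟩
    · rintro v ((rfl | hv) | (rfl | hv))
      · exact Or.inr ⟨j, k, hjt, hkt, hne, hjx, hjy, hkx, hky, ht⟩
      · exact hAU v hv
      · exact Or.inr ⟨j, k, hjt, hkt, hne, hjx, hjy, hkx, hky, ht⟩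
      · exact Or.inl ⟨k, hk, hkx, hky, hv⟩

/-- Three vertices joined to `x` and `y` whose third neighbors are linked avoiding `x` and `y`
span a `K₃,₃` minor. -/
theorem exists_isK33Model [DecidableEq ι] (h : G.IsTripleModel S T B N) {x y z : ι} (hxy : x ≠ y)
    (hz : z ∈ S) (hzx : z ≠ x) (hzy : z ≠ y) {t : Fin 3 → V} (ht : Function.Injective t)
    (htT : ∀ j, t j ∈ T) {w : Fin 3 → ι} (hN : ∀ j, N (t j) = {x, y, w j})
    (hl : ∀ j, LinkedAvoiding T N x y z (w j)) : ∃ A t, G.IsK33Model A t := by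
  choose _ A hA hzA hwA hAU using
    fun j => h.exists_connected_of_linkedAvoiding hz hzx hzy (hl j)
  have hx : x ∈ S := h.subset _ (htT 0) (by simp [hN])
  have hy : y ∈ S := h.subset _ (htT 0) (by simp [hN])
  obtain ⟨u, hu⟩ := (h.connected z hz).nonempty
  have hmem : ∀ v ∈ A 0 ∪ A 1 ∪ A 2, ∃ j, v ∈ A j := by
    rintro v ((hv | hv) | hv)
    exacts [⟨_, hv⟩, ⟨_, hv⟩, ⟨_, hv⟩]
  have hsub : ∀ j, A j ⊆ A 0 ∪ A 1 ∪ A 2 := by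
    intro j v hv
    fin_cases j
    exacts [Or.inl (Or.inl hv), Or.inl (Or.inr hv), Or.inr hv]
  have hdisj : ∀ r ∈ S, (r = x ∨ r = y) → Disjoint (B r) (A 0 ∪ A 1 ∪ A 2) := by
    intro r hr hrxy
    rw [Set.disjoint_left]
    intro v hv hv'
    obtain ⟨j, hj⟩ := hmem v hv'
    rcases hAU j v hj with ⟨k, hk, hkx, hky, hvk⟩ | ⟨k, l, -, -, -, -, -, -, -, hvT⟩
    · exact Set.disjoint_left.1 (h.disjoint r hr k hk (by grind)) hv hvk
    · exact h.notMem v hvT r hr hv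
  refine ⟨![B x, B y, A 0 ∪ A 1 ∪ A 2], t, ?_, ?_, ht, ?_, ?_⟩
  · intro i
    fin_cases i
    · exact h.connected x hx
    · exact h.connected y hy
    · exact induce_union_connected (induce_union_connected (hA 0).preconnected
        (hA 1).preconnected ⟨u, hzA 0 hu, hzA 1 hu⟩).preconnected (hA 2).preconnected
        ⟨u, Or.inl (hzA 0 hu), hzA 2 hu⟩
  · have h01 := h.disjoint x hx y hy hxy
    have h02 := hdisj x hx (Or.inl rfl)
    have h12 := hdisj y hy (Or.inr rfl)
    intro i k hik
    fin_cases i <;> fin_cases k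
    exacts [absurd rfl hik, h01, h02, h01.symm, absurd rfl hik, h12, h02.symm, h12.symm,
      absurd rfl hik]
  · intro i j
    fin_cases i
    · exact h.notMem _ (htT j) x hx
    · exact h.notMem _ (htT j) y hy
    · intro hj
      obtain ⟨m, hm⟩ := hmem _ hj
      rcases hAU m _ hm with ⟨k, hk, -, -, hvk⟩ | ⟨k, l, hk, hl, hkl, h1, h2, h3, h4, -⟩
      · exact h.notMem _ (htT j) k hk hvk
      · rw [hN] at hk hl
        simp only [Finset.mem_insert, Finset.mem_singleton, h1, h2, h3, h4, false_or] at hk hl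
        exact hkl (hk.trans hl.symm)
  · intro i j
    fin_cases i
    · exact h.adj _ (htT j) x (by simp [hN])
    · exact h.adj _ (htT j) y (by simp [hN])
    · obtain ⟨v, hv, hadj⟩ := h.adj _ (htT j) (w j) (by simp [hN])
      exact ⟨v, hsub j (hwA j hv), hadj⟩

open Classical in
/-- If every pair contained in a triple is contained in at least three triples, then there is a
`K₃,₃` minor. -/
theorem exists_isK33Model_of_two_lt_card (h : G.IsTripleModel S T B N) (hT : T.Nonempty)
    (h3 : ∀ t ∈ T, ∀ x ∈ N t, ∀ y ∈ N t, x ≠ y →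
      2 < (T.filter fun s => x ∈ N s ∧ y ∈ N s).card) : ∃ A t, G.IsK33Model A t := by
  by_contra hK
  suffices ∀ (n : ℕ) (x y z : ι) (t : V), t ∈ T → N t = {x, y, z} → x ≠ y → x ≠ z → y ≠ z →
      (S.filter (LinkedAvoiding T N x y z)).card = n → False by
    obtain ⟨t, ht⟩ := hT
    obtain ⟨x, y, z, hxy, hxz, hyz, hN⟩ := Finset.card_eq_three.1 (h.card_eq t ht)
    exact this _ x y z t ht hN hxy hxz hyz rfl
  intro n
  induction n using Nat.strong_induction_on with
  | _ n ih =>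
  rintro x y z t ht hN hxy hxz hyz rfl
  have hcard := h3 t ht x (by simp [hN]) z (by simp [hN]) hxz
  obtain ⟨t₀, h₀, t₁, h₁, t₂, h₂, h01, h02, h12⟩ := Finset.two_lt_card.1 hcard
  simp only [Finset.mem_filter] at h₀ h₁ h₂
  have third : ∀ s, s ∈ T ∧ x ∈ N s ∧ z ∈ N s → ∃ w, N s = {x, z, w} ∧ w ≠ x ∧ w ≠ z := by
    rintro s ⟨hs, hxs, hzs⟩
    obtain ⟨a, b, c, hab, hac, hbc, hNs⟩ := Finset.card_eq_three.1 (h.card_eq s hs)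
    rw [hNs] at hxs hzs ⊢
    simp only [Finset.mem_insert, Finset.mem_singleton] at hxs hzs
    rcases hxs with rfl | rfl | rfl <;> rcases hzs with rfl | rfl | rfl <;>
      first | exact absurd rfl hxz | skip
    · exact ⟨c, rfl, hac.symm, hbc.symm⟩
    · exact ⟨b, by grind, hab.symm, hbc⟩
    · exact ⟨c, by grind, hbc.symm, hac.symm⟩
    · exact ⟨a, by grind, hab, hac⟩
    · exact ⟨b, by grind, hbc, hab.symm⟩
    · exact ⟨a, by grind, hac, hab⟩
  have hy : y ∈ S := h.subset t ht (by simp [hN])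
  have hz : z ∈ S := h.subset t ht (by simp [hN])
  obtain ⟨s, w, hs, hNs, hwx, hwz, hw⟩ : ∃ s w, s ∈ T ∧ N s = {x, z, w} ∧ w ≠ x ∧ w ≠ z ∧
      ¬ LinkedAvoiding T N x z y w := by
    by_contra! hcon
    obtain ⟨w₀, hw₀, hx₀, hz₀⟩ := third t₀ h₀
    obtain ⟨w₁, hw₁, hx₁, hz₁⟩ := third t₁ h₁
    obtain ⟨w₂, hw₂, hx₂, hz₂⟩ := third t₂ h₂
    refine hK (h.exists_isK33Model (t := ![t₀, t₁, t₂]) (w := ![w₀, w₁, w₂]) hxz hy hxy.symm hyz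
      ?_ ?_ ?_ ?_)
    · intro i j hij
      fin_cases i <;> fin_cases j <;> simp_all
    · intro j; fin_cases j
      exacts [h₀.1, h₁.1, h₂.1]
    · intro j; fin_cases j
      exacts [hw₀, hw₁, hw₂]
    · intro j; fin_cases j
      exacts [hcon _ _ h₀.1 hw₀ hx₀ hz₀, hcon _ _ h₁.1 hw₁ hx₁ hz₁, hcon _ _ h₂.1 hw₂ hx₂ hz₂]
  have hwy : w ≠ y := by
    rintro rfl
    exact hw Relation.ReflTransGen.refl
  refine ih _ ?_ x z w s hs hNs hxz hwx.symm hwz.symm rfl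
  have hmono : ∀ i, LinkedAvoiding T N x z w i → i ≠ y ∧ LinkedAvoiding T N x y z i := by
    intro i hi
    induction hi with
    | refl =>
      exact ⟨hwy, Relation.ReflTransGen.single ⟨⟨hxz.symm, hyz.symm⟩, ⟨hwx, hwy⟩, s, hs,
        by simp [hNs], by simp [hNs]⟩⟩
    | @tail j k hj hjk ihj =>
      have hky : k ≠ y := by
        rintro rfl
        exact hw (LinkedAvoiding.symm (hj.tail hjk))
      obtain ⟨⟨hjx, -⟩, ⟨hkx, -⟩, hjk⟩ := hjk
      exact ⟨hky, ihj.2.tail ⟨⟨hjx, ihj.1⟩, ⟨hkx, hky⟩, hjk⟩⟩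
  apply Finset.card_lt_card
  rw [Finset.ssubset_iff_of_subset]
  · refine ⟨z, Finset.mem_filter.2 ⟨hz, Relation.ReflTransGen.refl⟩, fun hz' => ?_⟩
    exact (LinkedAvoiding.ne (Finset.mem_filter.1 hz').2 hwx hwz).2 rfl
  · intro i hi
    rw [Finset.mem_filter] at hi ⊢
    exact ⟨hi.1, (hmono i hi.2).2⟩

open Classical in
/-- Contracting `B x`, `B y` and a common neighbor of them into a single branch set. -/
theorem contract (h : G.IsTripleModel S T B N) {t₀ : V} (ht₀ : t₀ ∈ T) {x y : ι}
    (hx : x ∈ N t₀) (hy : y ∈ N t₀) (hxy : x ≠ y) :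
    G.IsTripleModel (S.erase y) (T.filter fun s => ¬ (x ∈ N s ∧ y ∈ N s))
      (Function.update B x (insert t₀ (B x) ∪ insert t₀ (B y)))
      (fun s => if y ∈ N s then insert x ((N s).erase y) else N s) := by
  have hxS := h.subset t₀ ht₀ hx
  have hyS := h.subset t₀ ht₀ hy
  have hdis : ∀ j ∈ S.erase y, j ≠ x → Disjoint (insert t₀ (B x) ∪ insert t₀ (B y)) (B j) := by
    intro j hj hjx
    rw [Finset.mem_erase] at hj
    rw [Set.disjoint_union_left, Set.disjoint_insert_left, Set.disjoint_insert_left]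
    exact ⟨⟨h.notMem _ ht₀ j hj.2, h.disjoint x hxS j hj.2 hjx.symm⟩,
      h.notMem _ ht₀ j hj.2, h.disjoint y hyS j hj.2 hj.1.symm⟩
  refine ⟨?_, ?_, ?_, ?_, ?_, ?_⟩
  · intro i hi
    by_cases hix : i = x
    · subst hix
      rw [Function.update_self]
      obtain ⟨u, hu, htu⟩ := h.adj t₀ ht₀ i hx
      obtain ⟨w, hw, htw⟩ := h.adj t₀ ht₀ y hy
      exact induce_union_connected ((h.connected i hxS).induce_insert hu htu).preconnected
        ((h.connected y hyS).induce_insert hw htw).preconnected ⟨t₀, Or.inl rfl, Or.inl rfl⟩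
    · rw [Function.update_of_ne hix]
      exact h.connected i (Finset.mem_of_mem_erase hi)
  · intro i hi j hj hij
    by_cases hix : i = x
    · subst hix
      rw [Function.update_self, Function.update_of_ne hij.symm]
      exact hdis j hj hij.symm
    · rw [Function.update_of_ne hix]
      by_cases hjx : j = x
      · subst hjx
        rw [Function.update_self]
        exact (hdis i hi hix).symm
      · rw [Function.update_of_ne hjx]
        exact h.disjoint i (Finset.mem_of_mem_erase hi) j (Finset.mem_of_mem_erase hj) hij
  · intro t ht i hi
    rw [Finset.mem_filter] at ht
    by_cases hix : i = x
    · subst hix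
      rw [Function.update_self]
      have htt : t ≠ t₀ := by
        rintro rfl
        exact ht.2 ⟨hx, hy⟩
      rintro ((h1 | h1) | (h1 | h1))
      exacts [htt h1, h.notMem t ht.1 i hxS h1, htt h1, h.notMem t ht.1 y hyS h1]
    · rw [Function.update_of_ne hix]
      exact h.notMem t ht.1 i (Finset.mem_of_mem_erase hi)
  · intro t ht i hi
    rw [Finset.mem_filter] at ht
    have := h.subset t ht.1
    grind
  · intro t ht
    rw [Finset.mem_filter] at ht
    have hc := h.card_eq t ht.1
    split_ifs with hyt
    · have hxt : x ∉ N t := fun hxt => ht.2 ⟨hxt, hyt⟩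
      rw [Finset.card_insert_of_notMem (fun hh => hxt (Finset.mem_of_mem_erase hh)),
        Finset.card_erase_of_mem hyt, hc]
    · exact hc
  · intro t ht i hi
    rw [Finset.mem_filter] at ht
    by_cases hix : i = x
    · subst hix
      rw [Function.update_self]
      by_cases hyt : y ∈ N t
      · obtain ⟨u, hu, htu⟩ := h.adj t ht.1 y hyt
        exact ⟨u, Or.inr (Or.inr hu), htu⟩
      · rw [if_neg hyt] at hi
        obtain ⟨u, hu, htu⟩ := h.adj t ht.1 i hi
        exact ⟨u, Or.inl (Or.inr hu), htu⟩
    · rw [Function.update_of_ne hix]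
      exact h.adj t ht.1 i (by grind)

theorem card_le (h : G.IsTripleModel S T B N) (hK : ∀ A t, ¬ G.IsK33Model A t) :
    T.card ≤ 2 * S.card := by
  classical
  induction hn : S.card generalizing S T B N with
  | zero =>
    rcases T.eq_empty_or_nonempty with rfl | ⟨t, ht⟩
    · simp
    · have := Finset.card_le_card (h.subset t ht)
      have := h.card_eq t ht
      omega
  | succ n ih =>
    rcases T.eq_empty_or_nonempty with rfl | hT
    · simp
    by_contra hlt
    obtain ⟨A, t, hA⟩ := h.exists_isK33Model_of_two_lt_card hT fun t ht x hx y hy hxy => by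
      by_contra! hle
      have := ih (h.contract ht hx hy hxy)
        (by rw [Finset.card_erase_of_mem (h.subset t ht hy), hn]; rfl)
      have := Finset.card_filter_add_card_filter_not (s := T) (fun s => x ∈ N s ∧ y ∈ N s)
      omega
    exact hK A t hA

end IsTripleModel

/-- In a planar graph, at most `2 * |S|` vertices outside `S` can have all of their at least
three neighbors in `S`. -/
theorem card_le_two_mul_of_planeEmbedding (P : PlaneEmbedding G) (S T : Finset V)
    (hST : Disjoint S T) (hT : ∀ t ∈ T, ∃ N ⊆ S, N.card = 3 ∧ ∀ u ∈ N, G.Adj t u) :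
    T.card ≤ 2 * S.card := by
  classical
  choose! N hN using hT
  refine IsTripleModel.card_le (G := G) (B := fun v => {v}) (N := N) ⟨?_, ?_, ?_, ?_, ?_, ?_⟩
    fun A t hA => hA.false_of_planeEmbedding P
  · intro i _
    have : Subsingleton ({i} : Set V) := Set.subsingleton_coe _ |>.2 Set.subsingleton_singleton
    exact ⟨Preconnected.of_subsingleton⟩
  · intro i _ j _ hij
    simpa using hij
  · intro t ht i hi hti
    exact Finset.disjoint_left.1 hST hi (Set.mem_singleton_iff.1 hti ▸ ht)
  · exact fun t ht => (hN t ht).1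
  · exact fun t ht => (hN t ht).2.1
  · exact fun t ht i hi => ⟨i, rfl, (hN t ht).2.2 i hi⟩

end SimpleGraph

namespace SimpleGraph

variable {V W : Type} {G : SimpleGraph V}

theorem Iso.ncard_oddComponents_le [Finite W] {H : SimpleGraph W} (φ : G ≃g H) :
    G.oddComponents.ncard ≤ H.oddComponents.ncard := by
  refine Set.ncard_le_ncard_of_injOn φ.connectedComponentEquiv (fun c hc => ?_)
    φ.connectedComponentEquiv.injective.injOn
  have : (φ.connectedComponentEquiv c).supp.ncard = c.supp.ncard := by
    rw [← Nat.card_coe_set_eq, ← Nat.card_coe_set_eq]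
    exact (Nat.card_congr (ConnectedComponent.isoEquivSupp φ c)).symm
  change Odd (φ.connectedComponentEquiv c).supp.ncard
  rw [this]
  exact hc

theorem Subgraph.IsMatching.ncard_verts_le [Finite V] {M : G.Subgraph} (h : M.IsMatching) :
    M.verts.ncard ≤ 2 * M.edgeSet.ncard := by
  classical
  have hfin : M.edgeSet.Finite := Set.toFinite _
  have hE : M.verts = ⋃ e ∈ hfin.toFinset, (e : Set V) := by
    rw [h.verts_eq_biUnion_edgeSet]; simp
  rw [hE, Set.ncard_eq_toFinset_card M.edgeSet hfin, mul_comm]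
  refine (Finset.set_ncard_biUnion_le _ _).trans (Finset.sum_le_card_nsmul _ _ _ fun e _ => ?_)
  induction e with
  | _ a b =>
    rw [Sym2.coe_mk]
    exact (Set.ncard_insert_le a {b}).trans (by simp)

/-- The graph obtained from `G` by adding `d` new vertices adjacent to everything. -/
def joinUniversal (G : SimpleGraph V) (d : ℕ) : SimpleGraph (V ⊕ Fin d) where
  Adj a b := a ≠ b ∧ ∀ u v, a = Sum.inl u → b = Sum.inl v → G.Adj u v
  symm := ⟨fun _ _ h => ⟨h.1.symm, fun u v hu hv => (h.2 v u hv hu).symm⟩⟩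
  loopless := ⟨fun _ h => h.1 rfl⟩

theorem joinUniversal_adj_inl {d : ℕ} {u v : V} :
    (G.joinUniversal d).Adj (Sum.inl u) (Sum.inl v) ↔ G.Adj u v := by
  constructor
  · exact fun h => h.2 u v rfl rfl
  · refine fun h => ⟨by simpa using h.ne, fun a b ha hb => ?_⟩
    rw [Sum.inl.injEq] at ha hb
    exact ha ▸ hb ▸ h

theorem joinUniversal_adj_inr {d : ℕ} {a : V ⊕ Fin d} {i : Fin d} (h : a ≠ Sum.inr i) :
    (G.joinUniversal d).Adj a (Sum.inr i) :=
  ⟨h, fun _ _ _ hb => by simp at hb⟩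

theorem not_isTutteViolator_joinUniversal [Finite V] {d : ℕ} (hpar : Even (Nat.card V + d))
    (h : ∀ S : Set V, (G.induce Sᶜ).oddComponents.ncard ≤ S.ncard + d) (u : Set (V ⊕ Fin d)) :
    ¬ (G.joinUniversal d).IsTutteViolator u := by
  intro hu
  unfold IsTutteViolator at hu
  by_cases hi : ∃ i, Sum.inr i ∉ u
  · obtain ⟨i, hi⟩ := hi
    set H := ((⊤ : (G.joinUniversal d).Subgraph).deleteVerts u) with hH
    have hmem : Sum.inr i ∈ H.verts := by simp [hH, hi]
    have hconn : H.coe.Preconnected := by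
      have key : ∀ x : H.verts, H.coe.Reachable x ⟨Sum.inr i, hmem⟩ := by
        intro x
        by_cases hx : x.1 = Sum.inr i
        · have : x = ⟨Sum.inr i, hmem⟩ := Subtype.ext hx
          rw [this]
        · apply Adj.reachable
          have hx2 := x.2
          simp only [hH, Subgraph.deleteVerts_verts, Subgraph.verts_top, Set.mem_sdiff] at hx2
          simp only [hH, Subgraph.coe_adj, Subgraph.deleteVerts_adj, Subgraph.verts_top,
            Set.mem_univ, true_and, Subgraph.top_adj]
          exact ⟨hx2.2, hi, joinUniversal_adj_inr hx⟩
      exact fun x y => (key x).trans (key y).symm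
    have hsub := hconn.subsingleton_connectedComponent
    have hle : H.coe.oddComponents.ncard ≤ 1 := Set.ncard_le_one_of_subsingleton _
    have hu0 : u = ∅ := by
      rw [← Set.ncard_eq_zero]; omega
    have h1 : H.coe.oddComponents.ncard = 1 := by omega
    have hodd := (H.coe.odd_ncard_oddComponents).1 (h1 ▸ odd_one)
    have hcard : Nat.card H.verts = Nat.card V + d := by
      rw [Nat.card_coe_set_eq, hH, hu0]
      simp [Set.ncard_univ, Nat.card_sum]
    rw [hcard] at hodd
    exact (Nat.not_odd_iff_even.2 hpar) hodd
  · push Not at hi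
    set S : Set V := Sum.inl ⁻¹' u with hS
    have hu' : u = Sum.inl '' S ∪ Set.range Sum.inr := by
      ext (a | i) <;> simp [hS, hi]
    have hcard : u.ncard = S.ncard + d := by
      rw [hu', Set.ncard_union_eq, Set.ncard_image_of_injective _ Sum.inl_injective,
        ← Set.image_univ, Set.ncard_image_of_injective _ Sum.inr_injective, Set.ncard_univ,
        Nat.card_eq_fintype_card, Fintype.card_fin]
      rw [Set.disjoint_left]
      rintro _ ⟨a, -, rfl⟩ ⟨i, hi⟩
      simp at hi
    have hbij : Function.Bijective (fun x : (Sᶜ : Set V) =>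
        (⟨Sum.inl x.1, by
          have hx : Sum.inl x.1 ∉ u := x.2
          simp [hx]⟩ :
          ((⊤ : (G.joinUniversal d).Subgraph).deleteVerts u).verts)) := by
      constructor
      · intro x y hxy
        simpa [Subtype.ext_iff] using hxy
      · rintro ⟨(a | i), hx⟩
        · exact ⟨⟨a, by simpa [hS] using hx⟩, rfl⟩
        · simp [hi] at hx
    let φ : G.induce Sᶜ ≃g ((⊤ : (G.joinUniversal d).Subgraph).deleteVerts u).coe :=
      { toEquiv := Equiv.ofBijective _ hbij
        map_rel_iff' := by
          rintro ⟨x, hx⟩ ⟨y, hy⟩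
          have hx' : Sum.inl x ∉ u := hx
          have hy' : Sum.inl y ∉ u := hy
          simp [joinUniversal_adj_inl, hx', hy'] }
    have := φ.symm.ncard_oddComponents_le
    have := h S
    omega

/-- The Tutte–Berge bound: deleting `S` leaves at most `|S| + d` odd components for every `S`, so
some matching misses at most `d` vertices. -/
theorem exists_isMatching_of_oddComponents_le [Finite V] {d : ℕ}
    (hpar : Even (Nat.card V + d))
    (h : ∀ S : Set V, (G.induce Sᶜ).oddComponents.ncard ≤ S.ncard + d) :
    ∃ M : G.Subgraph, M.IsMatching ∧ Nat.card V ≤ 2 * M.edgeSet.ncard + d := by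
  obtain ⟨M', hM'⟩ := tutte.2 (not_isTutteViolator_joinUniversal hpar h)
  rw [Subgraph.isPerfectMatching_iff] at hM'
  let M : G.Subgraph :=
    { verts := {a | ∃ b, M'.Adj (Sum.inl a) (Sum.inl b)}
      Adj := fun a b => M'.Adj (Sum.inl a) (Sum.inl b)
      adj_sub := fun hab => joinUniversal_adj_inl.1 hab.adj_sub
      edge_vert := fun hab => ⟨_, hab⟩
      symm := ⟨fun _ _ hab => hab.symm⟩ }
  have hM : M.IsMatching := by
    rintro a ⟨b, hab⟩
    refine ⟨b, hab, fun c hac => ?_⟩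
    exact Sum.inl_injective ((hM' (Sum.inl a)).unique hac hab)
  refine ⟨M, hM, ?_⟩
  have h1 := hM.ncard_verts_le
  have h2 : M.vertsᶜ.ncard ≤ d := by
    have : ∀ a : V, ∃ i, a ∈ M.vertsᶜ → M'.Adj (Sum.inl a) i := by
      intro a
      obtain ⟨x, hx, -⟩ := hM' (Sum.inl a)
      exact ⟨x, fun _ => hx⟩
    choose f hf using this
    have hle := Set.ncard_le_ncard_of_injOn (s := M.vertsᶜ)
      (t := Set.range (Sum.inr : Fin d → V ⊕ Fin d)) f
      (fun a ha => by
        rcases hfa : f a with b | i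
        · exact absurd ⟨b, hfa ▸ hf a ha⟩ ha
        · exact ⟨i, rfl⟩)
      (fun a ha b hb hab => Sum.inl_injective
        ((hM' (f a)).unique (hf a ha).symm (hab ▸ (hf b hb).symm)))
    rwa [← Set.image_univ, Set.ncard_image_of_injective _ Sum.inr_injective, Set.ncard_univ,
        Nat.card_eq_fintype_card, Fintype.card_fin] at hle
  have h3 := Set.ncard_add_ncard_compl M.verts
  omega

/-- A graph with `q` odd components and `m` isolated vertices has at least `3 * q - 2 * m` vertices. -/
theorem three_mul_ncard_oddComponents_le [Finite V] :
    3 * G.oddComponents.ncard ≤ Nat.card V + 2 * {v : V | ∀ w, ¬ G.Adj v w}.ncard := by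
  classical
  cases nonempty_fintype V
  set O : Finset G.ConnectedComponent := Finset.univ.filter fun c => Odd c.supp.ncard with hO
  have hOc : G.oddComponents.ncard = O.card := by
    rw [← Set.ncard_coe_finset]; congr; ext c; simp [hO]
  have hsum : ∑ c ∈ O, c.supp.ncard ≤ Nat.card V := by
    have := Finset.card_eq_sum_card_fiberwise (f := G.connectedComponentMk)
      (s := Finset.univ) (t := Finset.univ) (by simp)
    rw [Nat.card_eq_fintype_card, ← Finset.card_univ, this]
    refine (Finset.sum_le_sum_of_subset (Finset.subset_univ O)).trans
      (Finset.sum_le_sum fun c _ => ?_)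
    rw [← Set.ncard_coe_finset]
    apply le_of_eq; congr; ext v; simp
  have hone : (O.filter fun c => c.supp.ncard = 1).card ≤ {v : V | ∀ w, ¬ G.Adj v w}.ncard := by
    rw [← Set.ncard_coe_finset]
    refine Set.ncard_le_ncard_of_injOn Quot.out (fun c hc w hw => ?_)
      (fun c _ c' _ h => by rw [← c.out_eq, ← c'.out_eq, h])
    have hc1 : c.supp.ncard = 1 := by simpa [hO] using And.right (by simpa using hc)
    obtain ⟨a, ha⟩ := Set.ncard_eq_one.1 hc1
    have h1 : Quot.out c ∈ c.supp := c.out_eq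
    have h2 : w ∈ c.supp := (ConnectedComponent.mem_supp_congr_adj c hw).1 h1
    rw [ha] at h1 h2
    exact hw.ne (h1.trans h2.symm)
  have hlow : ∀ c ∈ O, 3 ≤ c.supp.ncard + 2 * if c.supp.ncard = 1 then 1 else 0 := by
    intro c hc
    have hodd : Odd c.supp.ncard := by simpa [hO] using hc
    obtain ⟨k, hk⟩ := hodd
    split_ifs <;> omega
  have := Finset.card_nsmul_le_sum O _ 3 hlow
  rw [Finset.sum_add_distrib, ← Finset.mul_sum, ← Finset.card_filter, smul_eq_mul] at this
  omega

/-- In a planar graph with minimum degree at least two, at most `2 * |S|` plus the number of vertices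
of degree two many vertices become isolated when `S` is deleted. -/
theorem ncard_isolated_le_of_planeEmbedding [Finite V] (P : PlaneEmbedding G)
    (hdeg : ∀ v : V, 2 ≤ (G.neighborSet v).ncard) (S : Set V) :
    {v : (Sᶜ : Set V) | ∀ w, ¬ (G.induce Sᶜ).Adj v w}.ncard ≤
      2 * S.ncard + {v : V | (G.neighborSet v).ncard = 2}.ncard := by
  classical
  cases nonempty_fintype V
  set D : Set V := {v | (G.neighborSet v).ncard = 2} with hD
  set T : Set V := {v | v ∉ S ∧ G.neighborSet v ⊆ S ∧ 3 ≤ (G.neighborSet v).ncard} with hT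
  have hTS : T.ncard ≤ 2 * S.ncard := by
    rw [Set.ncard_eq_toFinset_card', Set.ncard_eq_toFinset_card']
    refine card_le_two_mul_of_planeEmbedding P _ _ ?_ fun t ht => ?_
    · rw [Finset.disjoint_left]
      intro v hv hv'
      rw [Set.mem_toFinset] at hv hv'
      exact hv'.1 hv
    · rw [Set.mem_toFinset] at ht
      obtain ⟨-, hsub, h3⟩ := ht
      rw [Set.ncard_eq_toFinset_card'] at h3
      obtain ⟨N, hN, hN3⟩ := Finset.exists_subset_card_eq h3
      refine ⟨N, fun u hu => ?_, hN3, fun u hu => by simpa using hN hu⟩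
      exact Set.mem_toFinset.2 (hsub (Set.mem_toFinset.1 (hN hu)))
  have hle := Set.ncard_le_ncard_of_injOn
    (s := {v : (Sᶜ : Set V) | ∀ w, ¬ (G.induce Sᶜ).Adj v w}) (t := T ∪ D) Subtype.val
    (fun v hv => by
      have hsub : G.neighborSet v ⊆ S := fun w hw => by
        by_contra hwS
        exact hv ⟨w, hwS⟩ hw
      by_cases h2 : (G.neighborSet (v : V)).ncard = 2
      · exact Or.inr h2
      · exact Or.inl ⟨v.2, hsub, by have := hdeg v; omega⟩)
    Subtype.val_injective.injOn
  have := Set.ncard_union_le T D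
  omega

end SimpleGraph

/-- A connected planar graph on `n` vertices with minimum degree 2
and at most `c·n` vertices of degree 2 has a matching of size at least
`n/3 − (2/3)·c·n`. -/
theorem matching_of_few_degree_two_vertices {V : Type} [Fintype V]
    (G : SimpleGraph V) (c : ℝ)
    (hconn : G.Connected) (hplanar : Nonempty (PlaneEmbedding G))
    (hdeg : ∀ v : V, 2 ≤ (G.neighborSet v).ncard)
    (hc : (({v : V | (G.neighborSet v).ncard = 2} : Set V).ncard : ℝ) ≤
      c * Fintype.card V) :
    ∃ M : G.Subgraph, M.IsMatching ∧
      (Fintype.card V : ℝ) / 3 - 2 / 3 * c * Fintype.card V ≤ M.edgeSet.ncard := by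
  cases hplanar with | intro P =>
  set D : ℕ := {v : V | (G.neighborSet v).ncard = 2}.ncard with hD
  have hcard : 3 ≤ Nat.card V := by
    obtain ⟨v⟩ := hconn.nonempty
    have h1 := Set.ncard_insert_of_notMem (G.notMem_neighborSet_self (a := v))
    have h2 := Set.ncard_le_card (insert v (G.neighborSet v))
    have h3 := hdeg v
    omega
  obtain ⟨d, hd, hpar, hmax⟩ : ∃ d : ℕ, 3 * d ≤ Nat.card V + 4 * D ∧ Even (Nat.card V + d) ∧
      Nat.card V + 4 * D < 3 * (d + 2) := by
    rcases Nat.even_or_odd (Nat.card V + (Nat.card V + 4 * D) / 3) with he | ho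
    · exact ⟨_, by omega, he, by omega⟩
    · refine ⟨(Nat.card V + 4 * D) / 3 - 1, by omega, ?_, by omega⟩
      obtain ⟨k, hk⟩ := ho
      exact ⟨k, by omega⟩
  obtain ⟨M, hM, hle⟩ := SimpleGraph.exists_isMatching_of_oddComponents_le (G := G) hpar (by
    intro S
    have h1 := SimpleGraph.ncard_isolated_le_of_planeEmbedding P hdeg S
    have h2 := SimpleGraph.three_mul_ncard_oddComponents_le (G := G.induce Sᶜ)
    have h3 := Set.ncard_add_ncard_compl S
    have h4 := (G.induce Sᶜ).odd_ncard_oddComponents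
    rw [Nat.card_coe_set_eq] at h2 h4
    rw [Nat.odd_iff, Nat.odd_iff] at h4
    rw [Nat.even_iff] at hpar
    omega)
  refine ⟨M, hM, ?_⟩
  have h3 : Nat.card V ≤ 3 * M.edgeSet.ncard + 2 * D := by omega
  rw [Nat.card_eq_fintype_card] at h3
  have h4 : (Fintype.card V : ℝ) ≤ 3 * M.edgeSet.ncard + 2 * D := by exact_mod_cast h3
  linarith
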